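/- arXiv:2111.00312 — 4 statements merged into one kernel-verified Lean document; each statement's English description precedes it below -/
import Mathlib

section
/- For a finite vertex set V consisting of N+1 vertices with a distinguished root vertex r ∈ V (where N ≥ 1), the number of directed trees on V rooted at r equals (N+1)^(N-1). -/
/-- `p` is a directed path from `a` to `b` in the directed graph with edge
relation `E`: it is a nonempty list of vertices starting at `a`, ending at `b`,
with consecutive vertices joined by directed edges. -/
def IsDirPath {V : Type*} (E : V → V → Prop) (a b : V) (p : List V) : Prop :=
  p.head? = some a ∧ p.getLast? = some b ∧ p.Chain' E

/-- A directed graph (given by its edge relation `E`) on `V` is a directed tree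
rooted at `r` if for every vertex `w` there is a unique directed path from `r` to `w`. -/
def IsDirTree {V : Type*} (E : V → V → Prop) (r : V) : Prop :=
  ∀ w : V, ∃! p : List V, IsDirPath E r w p

section DirPath

variable {V : Type*} {E : V → V → Prop} {a b x : V} {p q : List V}

theorem IsDirPath.append_singleton (h : IsDirPath E a x q) (hE : E x b) :
    IsDirPath E a b (q ++ [b]) := by
  obtain ⟨h1, h2, h3⟩ := h
  refine ⟨?_, by simp, ?_⟩
  · simp [List.head?_append, h1]
  · refine List.isChain_append.2 ⟨h3, List.isChain_singleton _, ?_⟩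
    intro y hy z hz
    rw [h2] at hy
    simp only [List.head?_cons, Option.mem_def, Option.some.injEq] at hy hz
    exact hy ▸ hz ▸ hE

theorem isDirPath_iff :
    IsDirPath E a b p ↔
      (p = [a] ∧ a = b) ∨ ∃ q x, p = q ++ [b] ∧ IsDirPath E a x q ∧ E x b := by
  constructor
  · rintro ⟨h1, h2, h3⟩
    obtain ⟨q, rfl⟩ := List.getLast?_eq_some_iff.1 h2
    rcases List.eq_nil_or_concat q with rfl | ⟨l, x, rfl⟩
    · left
      simp_all
    · right
      obtain ⟨hq, -, hlast⟩ := List.isChain_append.1 h3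
      refine ⟨_, x, rfl, ⟨?_, by simp, hq⟩, ?_⟩
      · rw [List.head?_append_of_ne_nil _ (by simp)] at h1
        exact h1
      · exact hlast x (by simp) b (by simp)
  · rintro (⟨rfl, rfl⟩ | ⟨q, x, rfl, hq, hE⟩)
    · exact ⟨rfl, rfl, List.isChain_singleton _⟩
    · exact hq.append_singleton hE

theorem IsDirPath.end_unique {y : V} (h : IsDirPath E a x p) (h' : IsDirPath E a y p) :
    x = y :=
  Option.some.inj (h.2.1.symm.trans h'.2.1)

/-- A rooted directed tree is a well-founded relation in which the root has no predecessor and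
every other vertex has exactly one. -/
theorem isDirTree_iff {r : V} :
    IsDirTree E r ↔ (∀ x, ¬ E x r) ∧ (∀ y, y ≠ r → ∃! x, E x y) ∧ WellFounded E := by
  constructor
  · intro h
    choose P hP hu using h
    refine ⟨fun x hx => ?_, fun y hy => ?_, ?_⟩
    · have h1 := hu r _ ((hP x).append_singleton hx)
      have h2 := hu r [r] (isDirPath_iff.2 (Or.inl ⟨rfl, rfl⟩))
      have h3 : P x = [] := by
        have := h1.trans h2.symm
        simpa using this
      have := (hP x).1
      simp [h3] at this
    · rcases isDirPath_iff.1 (hP y) with ⟨-, h⟩ | ⟨q, x, -, -, hE⟩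
      · exact absurd h.symm hy
      · refine ⟨x, hE, fun x' hE' => ?_⟩
        have h1 := hu y _ ((hP x).append_singleton hE)
        have h2 := hu y _ ((hP x').append_singleton hE')
        have h3 : P x' = P x := List.append_cancel_right (h2.trans h1.symm)
        exact (hP x').end_unique (h3 ▸ hP x)
    · refine Subrelation.wf (r := InvImage (· < ·) fun v => (P v).length) ?_
        (InvImage.wf _ wellFounded_lt)
      intro x y hE
      have h1 := hu y _ ((hP x).append_singleton hE)
      change (P x).length < (P y).length
      rw [← h1]
      simp
  · rintro ⟨hr, hp, hwf⟩ w
    induction w using hwf.induction with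
    | h w ih =>
      by_cases hw : w = r
      · subst hw
        refine ⟨[w], isDirPath_iff.2 (Or.inl ⟨rfl, rfl⟩), fun p h => ?_⟩
        rcases isDirPath_iff.1 h with h | ⟨q, x, -, -, hE⟩
        · exact h.1
        · exact absurd hE (hr x)
      · obtain ⟨x, hx, hxu⟩ := hp w hw
        obtain ⟨p, hpx, hpu⟩ := ih x hx
        refine ⟨p ++ [w], hpx.append_singleton hx, fun p' h => ?_⟩
        rcases isDirPath_iff.1 h with h | ⟨q, x', rfl, hq, hE⟩
        · exact absurd h.2.symm hw
        · obtain rfl := hxu x' hE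
          rw [hpu q hq]

end DirPath

/-- The functions sending each vertex in `α` to a parent, which is either a root in `β` or another
vertex of `α`, such that following parents always leads to a root. -/
abbrev RootedForest (α β : Type*) : Type _ :=
  {f : α → β ⊕ α // WellFounded fun x y => f y = Sum.inr x}

namespace RootedForest

universe u

theorem isEmpty_of_isEmpty (α β : Type*) [Nonempty α] [IsEmpty β] :
    IsEmpty (RootedForest α β) := by
  refine ⟨fun ⟨f, hf⟩ => ?_⟩
  obtain ⟨a, -, ha⟩ := hf.has_min Set.univ Set.univ_nonempty
  rcases h : f a with b | a'
  · exact isEmptyElim b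
  · exact ha a' trivial h

theorem wellFounded_sumMap_iff {α β J K : Type*} (e : J ⊕ K ≃ α) (u : J → β) (v : K → J ⊕ K) :
    (WellFounded fun x y => Sum.map u (e ∘ v) (e.symm y) = Sum.inr x) ↔
      WellFounded fun x y => v y = Sum.inr x := by
  constructor
  · intro h
    refine Subrelation.wf ?_ (InvImage.wf (fun k => e (Sum.inr k)) h)
    intro x y hxy
    simp [InvImage, hxy]
  · intro h
    have hJ : ∀ j, Acc (fun x y => Sum.map u (e ∘ v) (e.symm y) = Sum.inr x) (e (Sum.inl j)) := by
      refine fun j => ⟨_, fun y hy => ?_⟩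
      simp at hy
    have hK : ∀ k, Acc (fun x y => Sum.map u (e ∘ v) (e.symm y) = Sum.inr x) (e (Sum.inr k)) := by
      intro k
      induction k using h.induction with
      | h k ih =>
        refine ⟨_, fun y hy => ?_⟩
        simp only [Equiv.symm_apply_apply, Sum.map_inr, Function.comp_apply,
          Sum.inr.injEq] at hy
        subst hy
        rcases hv : v k with j | k'
        · exact hJ j
        · exact ih k' hv
    refine ⟨fun a => ?_⟩
    obtain ⟨s, rfl⟩ := e.surjective a
    rcases s with j | k
    exacts [hJ j, hK k]

/-- A forest whose set of children of roots is `J` amounts to a choice of a root for each element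
of `J`, together with a forest on the complement of `J` with set of roots `J`. -/
theorem card_fiber {α β : Type*} [Finite α] [Finite β] (p : α → Prop) :
    Nat.card {f : RootedForest α β // ∀ a, (f.1 a).isLeft ↔ p a} =
      Nat.card β ^ Nat.card {a // p a} * Nat.card (RootedForest {a // ¬ p a} {a // p a}) := by
  classical
  let e : {a // p a} ⊕ {a // ¬ p a} ≃ α := Equiv.sumCompl p
  have hl : ∀ a (h : p a), e.symm a = Sum.inl ⟨a, h⟩ := fun a h => by
    rw [Equiv.symm_apply_eq]; rfl
  have hr : ∀ a (h : ¬ p a), e.symm a = Sum.inr ⟨a, h⟩ := fun a h => by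
    rw [Equiv.symm_apply_eq]; rfl
  rw [← Nat.card_fun, ← Nat.card_prod]
  symm
  refine Nat.card_congr (Equiv.ofBijective (fun g =>
    ⟨⟨fun y => Sum.map g.1 (e ∘ g.2.1) (e.symm y), (wellFounded_sumMap_iff e _ _).2 g.2.2⟩,
      fun a => ?_⟩) ⟨?_, ?_⟩)
  · by_cases h : p a
    · simp [hl a h, h]
    · simp [hr a h, h]
  · rintro ⟨u, v, hv⟩ ⟨u', v', hv'⟩ h
    have h' : ∀ s, Sum.map u (e ∘ v) s = Sum.map u' (e ∘ v') s := fun s => by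
      simpa using congrFun (congrArg (fun f => f.1.1) h) (e s)
    have hu : u = u' := funext fun j => by simpa using h' (Sum.inl j)
    have hv : v = v' := funext fun k => by simpa using h' (Sum.inr k)
    subst hu hv
    rfl
  · rintro ⟨⟨f, hf⟩, hfp⟩
    have hu : ∀ j : {a // p a}, ∃ b, f j = Sum.inl b := fun j =>
      Sum.isLeft_iff.1 ((hfp j).2 j.2)
    have hv : ∀ k : {a // ¬ p a}, ∃ s, f k = Sum.inr (e s) := fun k => by
      rcases h : f k with b | a
      · exact absurd ((hfp k).1 (by simp [h])) k.2
      · exact ⟨e.symm a, by simp⟩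
    choose u hu using hu
    choose v hv using hv
    have key : f = fun y => Sum.map u (e ∘ v) (e.symm y) := by
      funext y
      by_cases h : p y
      · simpa [hl y h] using hu ⟨y, h⟩
      · simpa [hr y h] using hv ⟨y, h⟩
    subst key
    exact ⟨⟨u, v, (wellFounded_sumMap_iff e _ _).1 hf⟩, rfl⟩

theorem card_eq_sum {α β : Type*} [Fintype α] [Finite β] :
    Nat.card (RootedForest α β) = ∑ J : Finset α,
      Nat.card β ^ J.card * Nat.card (RootedForest {a // a ∉ J} {a // a ∈ J}) := by
  classical
  have h : ∀ (f : RootedForest α β) (J : Finset α),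
      Finset.univ.filter (fun a => (f.1 a).isLeft) = J ↔ ∀ a, (f.1 a).isLeft ↔ a ∈ J := by
    intro f J
    simp [Finset.ext_iff]
  rw [← Nat.card_congr (Equiv.sigmaFiberEquiv fun f : RootedForest α β =>
    Finset.univ.filter fun a => (f.1 a).isLeft), Nat.card_sigma]
  refine Finset.sum_congr rfl fun J _ => ?_
  rw [Nat.card_congr (Equiv.subtypeEquivRight fun f => h f J), card_fiber]
  simp

theorem sum_range_choose_mul_mul_pow (m k l : ℕ) :
    ∑ j ∈ Finset.range (m + 2), (m + 1).choose j * (k ^ j * (j * l ^ (m + 1 - j))) =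
      (m + 1) * (k * (k + l) ^ m) := by
  rw [Finset.sum_range_succ', add_pow, Finset.mul_sum, Finset.mul_sum]
  simp only [zero_mul, mul_zero, add_zero]
  refine Finset.sum_congr rfl fun j _ => ?_
  have h := Nat.add_one_mul_choose_eq m j
  rw [Nat.add_sub_add_right]
  calc (m + 1).choose (j + 1) * (k ^ (j + 1) * ((j + 1) * l ^ (m - j)))
      _ = ((m + 1).choose (j + 1) * (j + 1)) * (k ^ (j + 1) * l ^ (m - j)) := by ring
      _ = _ := by
        rw [← h, Nat.cast_id]
        ring

theorem card_mul (n : ℕ) : ∀ (α β : Type u) [Finite α] [Finite β], Nat.card α = n →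
    (n + Nat.card β) * Nat.card (RootedForest α β) = Nat.card β * (n + Nat.card β) ^ n := by
  induction n using Nat.strong_induction_on with
  | _ n ih =>
    intro α β _ _ hn
    have := Fintype.ofFinite α
    rcases n with - | m
    · have : IsEmpty α := Finite.card_eq_zero_iff.1 hn
      have : Unique (RootedForest α β) :=
        { default := ⟨isEmptyElim, ⟨isEmptyElim⟩⟩
          uniq := fun f => Subtype.ext (Subsingleton.elim _ _) }
      simp
    · have hterm : ∀ J : Finset α,
          (m + 1) * Nat.card (RootedForest {a // a ∉ J} {a // a ∈ J}) =
            J.card * (m + 1) ^ (m + 1 - J.card) := by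
        classical
        intro J
        have hJ : Nat.card {a // a ∈ J} = J.card := by simp
        have hJc : Nat.card {a // a ∉ J} = m + 1 - J.card := by
          rw [Nat.card_eq_fintype_card, Fintype.card_subtype_compl, ← Nat.card_eq_fintype_card, hn]
          simp
        have hle : J.card ≤ m + 1 := by
          rw [← hn, Nat.card_eq_fintype_card]
          exact J.card_le_univ
        rcases J.eq_empty_or_nonempty with rfl | hne
        · have : Nonempty {a : α // a ∉ (∅ : Finset α)} :=
            (Nat.card_pos_iff.1 (by rw [hJc]; simp)).1
          have : IsEmpty {a : α // a ∈ (∅ : Finset α)} := 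
            ⟨fun a => Finset.notMem_empty _ a.2⟩
          have := isEmpty_of_isEmpty {a : α // a ∉ (∅ : Finset α)} {a : α // a ∈ (∅ : Finset α)}
          rw [Nat.card_of_isEmpty, Finset.card_empty, zero_mul, mul_zero]
        · have hpos := hne.card_pos
          have := ih (m + 1 - J.card) (by omega) {a // a ∉ J} {a // a ∈ J} hJc
          rwa [hJ, Nat.sub_add_cancel hle] at this
      have hsum : (m + 1) * Nat.card (RootedForest α β) =
          (m + 1) * (Nat.card β * (Nat.card β + (m + 1)) ^ m) := by
        rw [card_eq_sum, Finset.mul_sum, ← sum_range_choose_mul_mul_pow,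
          ← Finset.powerset_univ]
        have hcard : (Finset.univ : Finset α).card = m + 1 := by
          rw [Finset.card_univ, ← Nat.card_eq_fintype_card, hn]
        have := Finset.sum_powerset_apply_card
          (fun j => Nat.card β ^ j * (j * (m + 1) ^ (m + 1 - j)))
          (x := (Finset.univ : Finset α))
        rw [hcard] at this
        simp only [smul_eq_mul] at this
        rw [← this]
        refine Finset.sum_congr rfl fun J _ => ?_
        rw [← hterm J]
        ring
      rw [Nat.eq_of_mul_eq_mul_left m.succ_pos hsum]
      ring

end RootedForest

/-- Rooted directed trees correspond to forests on the non-root vertices with a single root. -/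
theorem ncard_isDirTree {V : Type*} (r : V) :
    {E : V → V → Prop | IsDirTree E r}.ncard =
      Nat.card (RootedForest {v // v ≠ r} PUnit) := by
  classical
  let e : PUnit ⊕ {v // v ≠ r} ≃ V := Equiv.ofBijective (Sum.elim (fun _ => r) Subtype.val) <| by
    constructor
    · rintro (a | a) (b | b) h
      · rfl
      · exact absurd h.symm b.2
      · exact absurd h a.2
      · exact congrArg Sum.inr (Subtype.ext h)
    · intro v
      by_cases h : v = r
      · exact ⟨Sum.inl ⟨⟩, h.symm⟩
      · exact ⟨Sum.inr ⟨v, h⟩, rfl⟩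
  have her : ∀ v, e (Sum.inr v) = v := fun _ => rfl
  rw [← Nat.card_coe_set_eq]
  symm
  refine Nat.card_congr (Equiv.ofBijective (fun f =>
    ⟨fun x y => ∃ h : y ≠ r, e (f.1 ⟨y, h⟩) = x, isDirTree_iff.2 ⟨?_, ?_, ?_⟩⟩) ⟨?_, ?_⟩)
  · rintro x ⟨h, -⟩
    exact h rfl
  · intro y hy
    exact ⟨_, ⟨hy, rfl⟩, fun x ⟨_, h⟩ => h.symm⟩
  · have hr : Acc (fun x y => ∃ h : y ≠ r, e (f.1 ⟨y, h⟩) = x) r := ⟨_, fun _ h => absurd rfl h.1⟩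
    have hv : ∀ v : {v // v ≠ r}, Acc (fun x y => ∃ h : y ≠ r, e (f.1 ⟨y, h⟩) = x) v := by
      intro v
      induction v using f.2.induction with
      | h v ih =>
        refine ⟨_, fun x ⟨_, hx⟩ => ?_⟩
        subst hx
        rcases hf : f.1 v with b | a
        · exact hr
        · exact ih a hf
    refine ⟨fun v => ?_⟩
    by_cases h : v = r
    · exact h ▸ hr
    · exact hv ⟨v, h⟩
  · intro f g h
    refine Subtype.ext (funext fun v => e.injective ?_)
    have h1 := congrFun (congrFun (congrArg Subtype.val h) (e (f.1 v))) v.1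
    obtain ⟨_, h2⟩ := h1.mp ⟨v.2, rfl⟩
    exact h2.symm
  · rintro ⟨E, hE⟩
    obtain ⟨h1, h2, h3⟩ := isDirTree_iff.1 hE
    choose p hp hu using h2
    refine ⟨⟨fun v => e.symm (p v.1 v.2), ?_⟩, ?_⟩
    · refine Subrelation.wf ?_ (InvImage.wf Subtype.val h3)
      intro x y hxy
      rw [Equiv.symm_apply_eq, her] at hxy
      change E x.1 y.1
      exact hxy ▸ hp y.1 y.2
    · refine Subtype.ext (funext fun x => funext fun y => propext ?_)
      simp only [Equiv.apply_symm_apply]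
      constructor
      · rintro ⟨h, rfl⟩
        exact hp y h
      · intro h
        have hy : y ≠ r := by
          rintro rfl
          exact h1 x h
        exact ⟨hy, (hu y hy x h).symm⟩

/-- For a finite vertex set `V` with `|V| = N + 1` (`N ≥ 1`) and distinguished
root `r ∈ V`, the number of directed trees on `V` rooted at `r` is `(N+1)^(N-1)`. -/
theorem num_rooted_directed_trees (V : Type*) [Fintype V] (r : V) (N : ℕ)
    (hN : 1 ≤ N) (hV : Fintype.card V = N + 1) :
    {E : V → V → Prop | IsDirTree E r}.ncard = (N + 1) ^ (N - 1) := by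
  classical
  have hα : Nat.card {v // v ≠ r} = N := by
    rw [Nat.card_eq_fintype_card, Fintype.card_subtype_compl, hV]
    simp
  have h := RootedForest.card_mul N {v // v ≠ r} PUnit hα
  rw [ncard_isDirTree]
  obtain ⟨m, rfl⟩ := Nat.exists_eq_add_of_le' hN
  rw [Nat.card_unique, one_mul, pow_succ'] at h
  exact Nat.eq_of_mul_eq_mul_left (Nat.succ_pos _) h
end

section
/- Let G = (V, E) be a directed tree rooted at r ∈ V, let v ∈ V with v ≠ r, let u' be the parent of v in G, and let u ∈ V be a vertex with u ≠ v that is not a descendant of v in G. Let G' = (V, (E \ {(u', v)}) ∪ {(u, v)}). Then: (a) the set of descendants of v in G' equals the set of descendants of v in G; and (b) for every vertex w ∈ V that is not a descendant of v in G, a sequence of vertices r = x₀, x₁, …, xₙ = w is a directed path from r to w in G' if and only if it is a directed path from r to w in G. -/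
/-- `w` is a descendant of `v` (including `v` itself): there is a directed path
from `v` to `w`. -/
def Descendant {V : Type*} (E : V → V → Prop) (v w : V) : Prop :=
  ∃ p : List V, IsDirPath E v w p

/-- The edge relation obtained from `E` by deleting the edge `(u', v)` and adding
the edge `(u, v)`. -/
def SevGraft {V : Type*} (E : V → V → Prop) (u' u v : V) : V → V → Prop :=
  fun a b => (E a b ∧ ¬(a = u' ∧ b = v)) ∨ (a = u ∧ b = v)

open Relation

theorem IsDirPath.reflTransGen {V : Type*} {E : V → V → Prop} {b : V} {p : List V} :
    ∀ {a : V}, IsDirPath E a b p → ReflTransGen E a b := by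
  induction p with
  | nil => rintro a ⟨h, -, -⟩; simp at h
  | cons x l ih =>
    rintro a ⟨h₁, h₂, h₃⟩
    obtain rfl : x = a := by simpa using h₁
    cases l with
    | nil =>
      obtain rfl : x = b := by simpa using h₂
      exact .refl
    | cons y l =>
      obtain ⟨hxy, hl⟩ := List.isChain_cons_cons.1 h₃
      exact .head hxy (ih ⟨rfl, by simpa using h₂, hl⟩)

theorem descendant_iff_reflTransGen {V : Type*} {E : V → V → Prop} {a b : V} :
    Descendant E a b ↔ ReflTransGen E a b := by
  refine ⟨fun ⟨_, hp⟩ => hp.reflTransGen, fun h => ?_⟩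
  induction h using ReflTransGen.head_induction_on with
  | refl => exact ⟨[b], rfl, rfl, List.isChain_singleton b⟩
  | @head a c hac _ ih =>
    obtain ⟨p, h₁, h₂, h₃⟩ := ih
    cases p with
    | nil => simp at h₁
    | cons x l =>
      obtain rfl : x = c := by simpa using h₁
      exact ⟨a :: x :: l, rfl, by simpa using h₂, List.isChain_cons_cons.2 ⟨hac, h₃⟩⟩

/-- A path ending outside the descendants of `v` remains a path under any edge relation that
keeps all edges pointing outside the descendants of `v`. -/
theorem IsDirPath.of_not_descendant {V : Type*} {E F : V → V → Prop} {v w : V}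
    (hEF : ∀ a b, ¬ Descendant E v b → E a b → F a b) (hw : ¬ Descendant E v w)
    {p : List V} : ∀ {a : V}, IsDirPath E a w p → IsDirPath F a w p := by
  induction p with
  | nil => rintro a ⟨h, -, -⟩; simp at h
  | cons x l ih =>
    rintro a ⟨h₁, h₂, h₃⟩
    refine ⟨h₁, h₂, ?_⟩
    cases l with
    | nil => exact List.isChain_singleton x
    | cons y l =>
      obtain ⟨hxy, hl⟩ := List.isChain_cons_cons.1 h₃
      have hy : IsDirPath E y w (y :: l) := ⟨rfl, by simpa using h₂, hl⟩
      refine List.isChain_cons_cons.2 ⟨hEF x y (fun hvy => hw ?_) hxy, (ih hy).2.2⟩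
      rw [descendant_iff_reflTransGen] at hvy ⊢
      exact hvy.trans hy.reflTransGen

theorem descendant_sevGraft_iff {V : Type*} {E : V → V → Prop} {u' u v : V}
    (hu : ¬ Descendant E v u) (w : V) :
    Descendant (SevGraft E u' u v) v w ↔ Descendant E v w := by
  simp only [descendant_iff_reflTransGen] at hu ⊢
  constructor
  · intro h
    induction h with
    | refl => exact .refl
    | tail _ hbc ih =>
      rcases hbc with ⟨hbc, -⟩ | ⟨rfl, -⟩
      · exact ih.tail hbc
      · exact absurd ih hu
  · intro h
    induction h with
    | refl => exact .refl
    | @tail b c _ hbc ih =>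
      by_cases hc : c = v
      · rw [hc]
      · exact ih.tail (.inl ⟨hbc, fun h => hc h.2⟩)

/-- Let `G = (V, E)` be a directed tree rooted at `r`, `v ≠ r` with parent `u'`
(i.e. `(u', v) ∈ E`), and let `u ≠ v` not be a descendant of `v`.  Let `G'` be
obtained from `G` by the sever-graft move replacing the edge `(u', v)` by `(u, v)`.
Then (a) the descendants of `v` in `G'` are exactly the descendants of `v` in `G`,
and (b) for every `w` that is not a descendant of `v` in `G`, a sequence of
vertices is a directed path from `r` to `w` in `G'` iff it is one in `G`. -/
theorem sever_graft_descendants_and_paths (V : Type*) [Fintype V]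
    (E : V → V → Prop) (r : V) (hE : IsDirTree E r)
    (v : V) (hv : v ≠ r) (u' : V) (hu' : E u' v)
    (u : V) (huv : u ≠ v) (hdesc : ¬ Descendant E v u) :
    (∀ w : V, Descendant (SevGraft E u' u v) v w ↔ Descendant E v w) ∧
    (∀ w : V, ¬ Descendant E v w →
      ∀ p : List V, IsDirPath (SevGraft E u' u v) r w p ↔ IsDirPath E r w p) := by
  have hiff := descendant_sevGraft_iff (u' := u') hdesc
  have hself : Descendant E v v := descendant_iff_reflTransGen.2 .refl
  refine ⟨hiff, fun w hw p => ⟨fun hp => ?_, fun hp => ?_⟩⟩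
  · refine hp.of_not_descendant (v := v) (fun a b hb hab => ?_) (by rwa [hiff])
    rw [hiff] at hb
    rcases hab with ⟨hab, -⟩ | ⟨-, rfl⟩
    · exact hab
    · exact absurd hself hb
  · refine hp.of_not_descendant (v := v) (fun a b hb hab => .inl ⟨hab, ?_⟩) hw
    rintro ⟨-, rfl⟩
    exact hb hself
end

section
/- Let (a, b, c) ∈ ℝ³ satisfy a² + b² + c² = 1 and c ≠ −1, and let φ ∈ ℝ. Define the quaternion q = (1/√(2(1 + c))) · ( (1 + c)·cos φ + (a·sin φ − b·cos φ)·i + (a·cos φ + b·sin φ)·j + (1 + c)·sin φ·k ). Then q is a unit quaternion, and conjugation by q sends the pure quaternion k to q · k · q̄ = a·i + b·j + c·k. -/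
open Quaternion

/-- Let `(a, b, c) ∈ ℝ³` with `a² + b² + c² = 1` and `c ≠ −1`, and let `φ ∈ ℝ`.
The quaternion
`q = (1/√(2(1+c))) · ((1+c)·cos φ + (a·sin φ − b·cos φ)·i + (a·cos φ + b·sin φ)·j + (1+c)·sin φ·k)`
is a unit quaternion, and conjugation by `q` sends the pure quaternion `k` to
`a·i + b·j + c·k`. -/
theorem hopf_section (a b c φ : ℝ) (h : a ^ 2 + b ^ 2 + c ^ 2 = 1) (hc : c ≠ -1) :
    let q := (1 / Real.sqrt (2 * (1 + c))) •
      (⟨(1 + c) * Real.cos φ, a * Real.sin φ - b * Real.cos φ,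
        a * Real.cos φ + b * Real.sin φ, (1 + c) * Real.sin φ⟩ : ℍ[ℝ])
    Quaternion.normSq q = 1 ∧
      q * (⟨0, 0, 0, 1⟩ : ℍ[ℝ]) * star q = (⟨0, a, b, c⟩ : ℍ[ℝ]) := by
  intro q
  have c_pos : 0 < 2 * (1 + c) := by
    have : -1 < c := lt_of_le_of_ne (by nlinarith [sq_nonneg a, sq_nonneg b]) hc.symm
    linarith
  have hs : (1 / Real.sqrt (2 * (1 + c))) ^ 2 * (2 * (1 + c)) = 1 := by
    rw [div_pow, Real.sq_sqrt c_pos.le, one_pow, one_div_mul_cancel c_pos.ne']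
  have trig := Real.sin_sq_add_cos_sq φ
  simp only [q]
  generalize 1 / Real.sqrt (2 * (1 + c)) = s at hs ⊢
  constructor
  · refine (Quaternion.normSq_def' _).trans ?_
    simp only [QuaternionAlgebra.re_smul, QuaternionAlgebra.imI_smul,
      QuaternionAlgebra.imJ_smul, QuaternionAlgebra.imK_smul, smul_eq_mul]
    linear_combination s ^ 2 * ((1 + c) ^ 2 + a ^ 2 + b ^ 2) * trig + s ^ 2 * h + hs
  · ext <;> simp only [QuaternionAlgebra.re_mul, QuaternionAlgebra.imI_mul,
      QuaternionAlgebra.imJ_mul, QuaternionAlgebra.imK_mul, QuaternionAlgebra.re_star,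
      QuaternionAlgebra.imI_star, QuaternionAlgebra.imJ_star, QuaternionAlgebra.imK_star,
      QuaternionAlgebra.re_smul, QuaternionAlgebra.imI_smul, QuaternionAlgebra.imJ_smul,
      QuaternionAlgebra.imK_smul, smul_eq_mul]
    · ring
    · linear_combination s ^ 2 * (2 * (1 + c)) * a * trig + a * hs
    · linear_combination s ^ 2 * (2 * (1 + c)) * b * trig + b * hs
    · linear_combination s ^ 2 * ((1 + c) ^ 2 - a ^ 2 - b ^ 2) * trig - s ^ 2 * h + c * hs
end

section
/- Let q = w + x·i + y·j + z·k be a unit quaternion with w > 0 and z ≠ 0. Set a = 2(xz + wy), b = 2(yz − wx), c = 1 − 2(x² + y²), and φ = arctan(z/w) (standard arctan with range (−π/2, π/2)). Then c ≠ −1, and the quaternion q' = (1/√(2(1 + c))) · ( (1 + c)·cos φ + (a·sin φ − b·cos φ)·i + (a·cos φ + b·sin φ)·j + (1 + c)·sin φ·k ) satisfies q' = q or q' = −q. In other words, the explicit Hopf-coordinate parametrization and its inverse compose to the identity up to the quaternion sign ambiguity. -/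
open Quaternion

/-- Let `q = w + x·i + y·j + z·k` be a unit quaternion with `w > 0` and `z ≠ 0`.
With `a = 2(xz + wy)`, `b = 2(yz − wx)`, `c = 1 − 2(x² + y²)` (the image of the
north pole under the rotation induced by `q`) and `φ = arctan(z/w)`, we have
`c ≠ −1`, and the explicit Hopf-coordinate section
`q' = (1/√(2(1+c))) · ((1+c)·cos φ + (a·sin φ − b·cos φ)·i + (a·cos φ + b·sin φ)·j + (1+c)·sin φ·k)`
satisfies `q' = q` or `q' = −q`. -/
theorem hopf_roundtrip (w x y z : ℝ) (h : w ^ 2 + x ^ 2 + y ^ 2 + z ^ 2 = 1)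
    (hw : 0 < w) (hz : z ≠ 0) :
    let a := 2 * (x * z + w * y)
    let b := 2 * (y * z - w * x)
    let c := 1 - 2 * (x ^ 2 + y ^ 2)
    let φ := Real.arctan (z / w)
    let q := (⟨w, x, y, z⟩ : ℍ[ℝ])
    let q' := (1 / Real.sqrt (2 * (1 + c))) •
      (⟨(1 + c) * Real.cos φ, a * Real.sin φ - b * Real.cos φ,
        a * Real.cos φ + b * Real.sin φ, (1 + c) * Real.sin φ⟩ : ℍ[ℝ])
    c ≠ -1 ∧ (q' = q ∨ q' = -q) := by
  intro a b c φ q q'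
  have hpos : 0 < w ^ 2 + z ^ 2 := by positivity
  obtain ⟨r, hr, hr2⟩ : ∃ r : ℝ, 0 < r ∧ r ^ 2 = w ^ 2 + z ^ 2 :=
    ⟨√(w ^ 2 + z ^ 2), Real.sqrt_pos.2 hpos, Real.sq_sqrt hpos.le⟩
  have hc : 1 + c = 2 * r ^ 2 := by simp only [c]; linarith
  have hsqrt : √(2 * (1 + c)) = 2 * r := by
    rw [hc, show 2 * (2 * r ^ 2) = (2 * r) ^ 2 by ring]
    exact Real.sqrt_sq (by positivity)
  have hsec : √(1 + (z / w) ^ 2) = r / w := by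
    rw [show 1 + (z / w) ^ 2 = (r / w) ^ 2 by rw [div_pow, div_pow, hr2]; field_simp]
    exact Real.sqrt_sq (by positivity)
  have hcos : Real.cos φ = w / r := by
    simp only [φ, Real.cos_arctan, hsec, one_div_div]
  have hsin : Real.sin φ = z / r := by
    simp only [φ, Real.sin_arctan, hsec]
    field_simp
  refine ⟨fun hc' => ?_, Or.inl ?_⟩
  · have : 0 < r ^ 2 := by positivity
    linarith
  · simp only [q', q, hsqrt, hcos, hsin]
    simp only [hc]
    ext <;> simp only [QuaternionAlgebra.re_smul, QuaternionAlgebra.imI_smul,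
      QuaternionAlgebra.imJ_smul, QuaternionAlgebra.imK_smul, smul_eq_mul, a, b] <;> field_simp
    · linear_combination (-x) * hr2
    · linear_combination (-y) * hr2
end
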